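/- Let G = G1 ×_I G2 be a discrete cusp with I ⊆ V2 nonempty and |V2| ≥ 2, and assume λ1 := inf σ(Δ_{G2,θ2}) > 0 (the smallest eigenvalue of Δ_{G2,θ2} is positive). Then: the form domains coincide, D(Δ_{G,θ}^{1/2}) = D(deg_G^{1/2}(·)); deg_G(x,y) → ∞ as (x,y) → ∞; Δ_{G,θ} has compact resolvent; and with D := max_{y∈V2} deg_{G2}(y), 0 < λ1/D ≤ liminf_{n→∞} λ_n(Δ_{G,θ})/λ_n(deg_G(·)) ≤ limsup_{n→∞} λ_n(Δ_{G,θ})/λ_n(deg_G(·)) ≤ 2, where λ_n(deg_G(·)) denotes the n-th value of deg_G arranged in nondecreasing order (the n-th eigenvalue of the multiplication operator by deg_G on ℓ²(V,m)). -/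

import Mathlib

open scoped BigOperators ENNReal

noncomputable section

namespace MagneticCusp

attribute [local instance] Classical.propDecidable

variable {V V1 V2 : Type*}

/-- The axioms of a weighted graph `(E, V, m)`: `E` is symmetric, non-negative,
with no loops, `m` is a positive weight, and the graph is locally finite. -/
def GraphAxioms (E : V → V → ℝ) (m : V → ℝ) : Prop :=
  (∀ x y, E x y = E y x) ∧ (∀ x y, 0 ≤ E x y) ∧ (∀ x, E x x = 0) ∧ (∀ x, 0 < m x) ∧
    ∀ x, {y | 0 < E x y}.Finite

/-- Connectedness of the graph with edge weight `E`. -/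
def Conn (E : V → V → ℝ) : Prop :=
  ∀ x y, Relation.ReflTransGen (fun a b => 0 < E a b) x y

/-- A (real representative of a) magnetic potential: antisymmetric, vanishing off edges. -/
def MagneticPotential (E θ : V → V → ℝ) : Prop :=
  (∀ x y, θ y x = -θ x y) ∧ ∀ x y, E x y = 0 → θ x y = 0

/-- `γ` is a cycle of length `N` in the graph with edge weight `E`. -/
def IsCycle (E : V → V → ℝ) (γ : ℕ → V) (N : ℕ) : Prop :=
  γ N = γ 0 ∧ ∀ i < N, 0 < E (γ i) (γ (i + 1))

/-- The holonomy (flux) of the magnetic potential `θ` along `γ` (a real representative;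
it is to be considered modulo `2π`). -/
def hol (θ : V → V → ℝ) (γ : ℕ → V) (N : ℕ) : ℝ :=
  ∑ i ∈ Finset.range N, θ (γ i) (γ (i + 1))

/-- `Hol_θ = 0`: every cycle has vanishing holonomy in `ℝ/2πℤ`. -/
def HolTrivial (E θ : V → V → ℝ) : Prop :=
  ∀ (γ : ℕ → V) (N : ℕ), IsCycle E γ N → ∃ k : ℤ, hol θ γ N = 2 * Real.pi * k

/-- The magnetic Laplacian `Δ_{G,θ}` acting on functions. -/
def lap (E : V → V → ℝ) (m : V → ℝ) (θ : V → V → ℝ) (f : V → ℂ) (x : V) : ℂ :=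
  ((m x : ℝ) : ℂ)⁻¹ *
    ∑' y, ((E x y : ℝ) : ℂ) * (f x - Complex.exp (((θ x y : ℝ) : ℂ) * Complex.I) * f y)

/-- The magnetic quadratic form `Q_{G,θ}`. -/
def quadForm (E θ : V → V → ℝ) (f : V → ℂ) : ℝ :=
  (1 / 2) * ∑' x, ∑' y, E x y * ‖f x - Complex.exp (((θ x y : ℝ) : ℂ) * Complex.I) * f y‖ ^ 2

/-- The degree `deg_G(x) = m(x)⁻¹ Σ_y E(x,y)`. -/
def degree (E : V → V → ℝ) (m : V → ℝ) (x : V) : ℝ := (m x)⁻¹ * ∑' y, E x y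

/-- The squared norm of `f` in `ℓ²(V,m)`. -/
def nrmSq (m : V → ℝ) (f : V → ℂ) : ℝ := ∑' x, m x * ‖f x‖ ^ 2

/-- Membership in `ℓ²(V,m)`. -/
def MemL2 (m : V → ℝ) (f : V → ℂ) : Prop := Summable fun x => m x * ‖f x‖ ^ 2

/-- The quadratic form `⟨f, deg_G(·) f⟩` of the multiplication operator by the degree. -/
def degForm (E : V → V → ℝ) (m : V → ℝ) (f : V → ℂ) : ℝ :=
  ∑' x, m x * degree E m x * ‖f x‖ ^ 2

/-- Weight of the product of two weighted graphs. -/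
def prodM (m1 : V1 → ℝ) (m2 : V2 → ℝ) : V1 × V2 → ℝ := fun p => m1 p.1 * m2 p.2

/-- Edge weight of the product of `G1` by `G2` through `I ⊆ V2`. -/
def prodE (E1 : V1 → V1 → ℝ) (E2 : V2 → V2 → ℝ) (I : Set V2) :
    V1 × V2 → V1 × V2 → ℝ := fun p q =>
  (if p.2 = q.2 ∧ p.2 ∈ I then E1 p.1 q.1 else 0) + (if p.1 = q.1 then E2 p.2 q.2 else 0)

/-- Edge weight of the Cartesian product of `G1` by `G2`. -/
def cartE (E1 : V1 → V1 → ℝ) (m1 : V1 → ℝ) (E2 : V2 → V2 → ℝ) (m2 : V2 → ℝ) :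
    V1 × V2 → V1 × V2 → ℝ := fun p q =>
  (if p.2 = q.2 then E1 p.1 q.1 * m2 p.2 else 0) + (if p.1 = q.1 then m1 p.1 * E2 p.2 q.2 else 0)

/-- Magnetic potential of the product of `G1` by `G2`. -/
def prodTheta (θ1 : V1 → V1 → ℝ) (θ2 : V2 → V2 → ℝ) : V1 × V2 → V1 × V2 → ℝ := fun p q =>
  (if p.2 = q.2 then θ1 p.1 q.1 else 0) + (if p.1 = q.1 then θ2 p.2 q.2 else 0)

/-- Hypothesis (H1): `m1(x) → 0` as `x → ∞` (on an infinite vertex set). -/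
def H1cond (m1 : V1 → ℝ) : Prop :=
  Infinite V1 ∧ ∀ ε : ℝ, 0 < ε → {x : V1 | ε ≤ m1 x}.Finite

/-- Hypothesis (H3): the degree of `G1` is bounded. -/
def H3cond (E1 : V1 → V1 → ℝ) (m1 : V1 → ℝ) : Prop :=
  ∃ d : ℝ, ∀ x, degree E1 m1 x ≤ d

/-- The quadratic form of the operator `m1⁻¹(·) ⊗ Δ_{G2,θ2}` on `ℓ²(V1 × V2, m1 ⊗ m2)`:
`⟨f, (m1⁻¹(·) ⊗ Δ_{G2,θ2}) f⟩ = Σ_x Q_{G2,θ2}(f(x,·))`. -/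
def fiberForm (E2 θ2 : V2 → V2 → ℝ) (f : V1 × V2 → ℂ) : ℝ :=
  ∑' x : V1, quadForm E2 θ2 fun y => f (x, y)

/-- A simple cycle: closed walk of length `≥ 3` with pairwise distinct vertices. -/
def IsSimpleCycle (E : V → V → ℝ) (γ : ℕ → V) (N : ℕ) : Prop :=
  3 ≤ N ∧ γ N = γ 0 ∧ (∀ i < N, 0 < E (γ i) (γ (i + 1))) ∧
    ∀ i < N, ∀ j < N, γ i = γ j → i = j

/-- The weighted length of an edge, `L_G(x,y) = sqrt(min(m x, m y)/E x y)`. -/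
def edgeLength (E : V → V → ℝ) (m : V → ℝ) (x y : V) : ℝ :=
  Real.sqrt (min (m x) (m y) / E x y)

/-- The weighted length of a cycle. -/
def cycleLength (E : V → V → ℝ) (m : V → ℝ) (γ : ℕ → V) (N : ℕ) : ℝ :=
  ∑ i ∈ Finset.range N, edgeLength E m (γ i) (γ (i + 1))

/-- The (weighted) girth: infimum of the weighted lengths of simple cycles (`∞` if none). -/
def girth (E : V → V → ℝ) (m : V → ℝ) : ℝ≥0∞ :=
  ⨅ c : {c : (ℕ → V) × ℕ // IsSimpleCycle E c.1 c.2},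
    ENNReal.ofReal (cycleLength E m c.1.1 c.1.2)

/-- The radius of injectivity: half the girth. -/
def injRad (E : V → V → ℝ) (m : V → ℝ) : ℝ≥0∞ := girth E m / 2

/-- Min-max encoding: there is an `n`-dimensional subspace of finitely supported
functions (the form core) on which `Q ≤ lam ‖·‖²_{ℓ²(V,m)}`.  For the self-adjoint
operator associated to the form `Q` with form core `C_c(V)` this says
`N_lam(H) = dim ran 1_{(-∞,lam]}(H) ≥ n`. -/
def DimGE (Q : (V → ℂ) → ℝ) (m : V → ℝ) (lam : ℝ) (n : ℕ) : Prop :=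
  ∃ g : Fin n → V → ℂ, LinearIndependent ℂ g ∧
    (∀ i, (Function.support (g i)).Finite) ∧
    ∀ f ∈ Submodule.span ℂ (Set.range g), Q f ≤ lam * nrmSq m f

/-- Compact resolvent (equivalently: empty essential spectrum) of the non-negative
self-adjoint operator associated to the form `Q`, encoded via min-max:
`N_lam(H) < ∞` for every `lam`. -/
def CompactResolvent (Q : (V → ℂ) → ℝ) (m : V → ℝ) : Prop :=
  ∀ lam : ℝ, ∃ n : ℕ, ∀ k : ℕ, DimGE Q m lam k → k ≤ n

/-- The eigenvalue counting function `N_lam(H) = dim ran 1_{(-∞,lam]}(H)`,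
encoded via min-max over the form core. -/
def countEig (Q : (V → ℂ) → ℝ) (m : V → ℝ) (lam : ℝ) : ℕ :=
  sSup {k : ℕ | DimGE Q m lam k}

/-- The `n`-th eigenvalue (counted with multiplicity, `n` starting at `0`) of the
self-adjoint operator associated to `Q`, via the Courant min-max principle. -/
def eigVal (Q : (V → ℂ) → ℝ) (m : V → ℝ) (n : ℕ) : ℝ :=
  sInf {t : ℝ | DimGE Q m t (n + 1)}

/-- Equality of the form domains of the two non-negative forms `Q1`, `Q2`, both with
form core the finitely supported functions: by the closed graph theorem this is
equivalent to the equivalence of the form norms on the common core. -/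
def SameFormDomain (Q1 Q2 : (V → ℂ) → ℝ) (m : V → ℝ) : Prop :=
  ∃ c1 c2 : ℝ, 0 < c1 ∧ 0 < c2 ∧ ∀ f : V → ℂ, (Function.support f).Finite →
    c1 * (nrmSq m f + Q1 f) ≤ nrmSq m f + Q2 f ∧
      nrmSq m f + Q2 f ≤ c2 * (nrmSq m f + Q1 f)


theorem GraphAxioms.summable_edge {E : V → V → ℝ} {m : V → ℝ} (h : GraphAxioms E m) (x : V) :
    Summable (E x) :=
  summable_of_hasFiniteSupport <| (h.2.2.2.2 x).subset fun y hy =>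
    lt_of_le_of_ne (h.2.1 x y) (Ne.symm hy)

theorem GraphAxioms.weight_mul_degree {E : V → V → ℝ} {m : V → ℝ} (h : GraphAxioms E m) (x : V) :
    m x * degree E m x = ∑' y, E x y := by
  rw [degree, mul_inv_cancel_left₀ (h.2.2.2.1 x).ne']

theorem GraphAxioms.degree_nonneg {E : V → V → ℝ} {m : V → ℝ} (h : GraphAxioms E m) (x : V) :
    0 ≤ degree E m x :=
  mul_nonneg (inv_nonneg.2 (h.2.2.2.1 x).le) (tsum_nonneg (h.2.1 x))

theorem nrmSq_nonneg {m : V → ℝ} (hm : ∀ x, 0 < m x) (f : V → ℂ) : 0 ≤ nrmSq m f :=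
  tsum_nonneg fun x => mul_nonneg (hm x).le (sq_nonneg _)

theorem GraphAxioms.quadForm_nonneg {E : V → V → ℝ} {m : V → ℝ} (h : GraphAxioms E m)
    (θ : V → V → ℝ) (f : V → ℂ) : 0 ≤ quadForm E θ f :=
  mul_nonneg (by norm_num)
    (tsum_nonneg fun x => tsum_nonneg fun y => mul_nonneg (h.2.1 x y) (sq_nonneg _))

theorem GraphAxioms.degForm_nonneg {E : V → V → ℝ} {m : V → ℝ} (h : GraphAxioms E m)
    (f : V → ℂ) : 0 ≤ degForm E m f :=
  tsum_nonneg fun x =>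
    mul_nonneg (mul_nonneg (h.2.2.2.1 x).le (h.degree_nonneg x)) (sq_nonneg _)

theorem summable_mul_norm_sq {f : V → ℂ} (hf : (Function.support f).Finite) (w : V → ℝ) :
    Summable fun x => w x * ‖f x‖ ^ 2 :=
  summable_of_hasFiniteSupport <| hf.subset fun x hx hfx => hx (by simp [hfx])

theorem GraphAxioms.summable_edge_mul {E : V → V → ℝ} {m : V → ℝ} (h : GraphAxioms E m)
    {f : V → ℂ} (hf : (Function.support f).Finite) :
    Summable fun p : V × V => E p.1 p.2 * ‖f p.1‖ ^ 2 := by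
  refine summable_of_hasFiniteSupport <|
    (hf.biUnion fun x _ => (h.2.2.2.2 x).image fun y => (x, y)).subset ?_
  rintro ⟨x, y⟩ hxy
  have hE : E x y ≠ 0 := fun h0 => hxy (by simp [h0])
  have hx : f x ≠ 0 := fun h0 => hxy (by simp [h0])
  exact Set.mem_biUnion (x := x) hx ⟨y, lt_of_le_of_ne (h.2.1 x y) hE.symm, rfl⟩

theorem GraphAxioms.summable_edge_mul_swap {E : V → V → ℝ} {m : V → ℝ} (h : GraphAxioms E m)
    {f : V → ℂ} (hf : (Function.support f).Finite) :
    Summable fun p : V × V => E p.1 p.2 * ‖f p.2‖ ^ 2 := by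
  refine ((Equiv.prodComm V V).summable_iff.2 (h.summable_edge_mul hf)).congr fun p => ?_
  simp [h.1 p.1 p.2]

theorem GraphAxioms.tsum_edge_mul {E : V → V → ℝ} {m : V → ℝ} (h : GraphAxioms E m)
    {f : V → ℂ} (hf : (Function.support f).Finite) :
    ∑' p : V × V, E p.1 p.2 * ‖f p.1‖ ^ 2 = degForm E m f := by
  rw [(h.summable_edge_mul hf).tsum_prod, degForm]
  refine tsum_congr fun x => ?_
  rw [h.weight_mul_degree, ← tsum_mul_right]

theorem GraphAxioms.tsum_edge_mul_swap {E : V → V → ℝ} {m : V → ℝ} (h : GraphAxioms E m)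
    {f : V → ℂ} (hf : (Function.support f).Finite) :
    ∑' p : V × V, E p.1 p.2 * ‖f p.2‖ ^ 2 = degForm E m f := by
  rw [← h.tsum_edge_mul hf, ← (Equiv.prodComm V V).tsum_eq]
  refine tsum_congr fun p => ?_
  simp [h.1 p.1 p.2]

theorem norm_sub_phase_mul_sq_le (t : ℝ) (a b : ℂ) :
    ‖a - Complex.exp ((t : ℂ) * Complex.I) * b‖ ^ 2 ≤ 2 * ‖a‖ ^ 2 + 2 * ‖b‖ ^ 2 := by
  have h := norm_sub_le a (Complex.exp ((t : ℂ) * Complex.I) * b)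
  rw [norm_mul, Complex.norm_exp_ofReal_mul_I, one_mul] at h
  nlinarith [sq_nonneg (‖a‖ - ‖b‖), norm_nonneg (a - Complex.exp ((t : ℂ) * Complex.I) * b)]

theorem GraphAxioms.summable_energy {E : V → V → ℝ} {m : V → ℝ} (h : GraphAxioms E m)
    (θ : V → V → ℝ) {f : V → ℂ} (hf : (Function.support f).Finite) :
    Summable fun p : V × V =>
      E p.1 p.2 * ‖f p.1 - Complex.exp (((θ p.1 p.2 : ℝ) : ℂ) * Complex.I) * f p.2‖ ^ 2 := by
  refine Summable.of_nonneg_of_le (fun p => mul_nonneg (h.2.1 _ _) (sq_nonneg _)) (fun p => ?_)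
    (((h.summable_edge_mul hf).mul_left 2).add ((h.summable_edge_mul_swap hf).mul_left 2))
  calc _ ≤ E p.1 p.2 * (2 * ‖f p.1‖ ^ 2 + 2 * ‖f p.2‖ ^ 2) :=
        mul_le_mul_of_nonneg_left (norm_sub_phase_mul_sq_le _ _ _) (h.2.1 _ _)
    _ = _ := by ring

theorem GraphAxioms.quadForm_eq {E : V → V → ℝ} {m : V → ℝ} (h : GraphAxioms E m)
    (θ : V → V → ℝ) {f : V → ℂ} (hf : (Function.support f).Finite) :
    quadForm E θ f = (1 / 2) * ∑' p : V × V,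
      E p.1 p.2 * ‖f p.1 - Complex.exp (((θ p.1 p.2 : ℝ) : ℂ) * Complex.I) * f p.2‖ ^ 2 := by
  rw [quadForm, (h.summable_energy θ hf).tsum_prod]

theorem GraphAxioms.quadForm_le_two_mul_degForm {E : V → V → ℝ} {m : V → ℝ}
    (h : GraphAxioms E m) (θ : V → V → ℝ) {f : V → ℂ} (hf : (Function.support f).Finite) :
    quadForm E θ f ≤ 2 * degForm E m f := by
  have h1 := (h.summable_edge_mul hf).mul_left 2
  have h2 := (h.summable_edge_mul_swap hf).mul_left 2
  have key := (h.summable_energy θ hf).tsum_le_tsum (g := fun p : V × V =>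
    2 * (E p.1 p.2 * ‖f p.1‖ ^ 2) + 2 * (E p.1 p.2 * ‖f p.2‖ ^ 2)) (fun p => by
      calc _ ≤ E p.1 p.2 * (2 * ‖f p.1‖ ^ 2 + 2 * ‖f p.2‖ ^ 2) :=
            mul_le_mul_of_nonneg_left (norm_sub_phase_mul_sq_le _ _ _) (h.2.1 _ _)
        _ = _ := by ring) (h1.add h2)
  rw [h1.tsum_add h2, tsum_mul_left, tsum_mul_left, h.tsum_edge_mul hf,
    h.tsum_edge_mul_swap hf] at key
  rw [h.quadForm_eq θ hf]
  linarith

theorem nrmSq_pos {m : V → ℝ} (hm : ∀ x, 0 < m x) {f : V → ℂ}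
    (hf : (Function.support f).Finite) (hf0 : f ≠ 0) : 0 < nrmSq m f := by
  obtain ⟨x, hx⟩ := Function.ne_iff.1 hf0
  exact (summable_mul_norm_sq hf m).tsum_pos
    (fun y => mul_nonneg (hm y).le (sq_nonneg _)) x
    (mul_pos (hm x) (pow_pos (norm_pos_iff.2 hx) 2))

theorem finite_support_of_mem_span {n : ℕ} {g : Fin n → V → ℂ}
    (hg : ∀ i, (Function.support (g i)).Finite) {f : V → ℂ}
    (hf : f ∈ Submodule.span ℂ (Set.range g)) : (Function.support f).Finite := by
  induction hf using Submodule.span_induction with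
  | mem x hx => obtain ⟨i, rfl⟩ := hx; exact hg i
  | zero => simp
  | add x y _ _ hx hy => exact (hx.union hy).subset (Function.support_add x y)
  | smul a x _ hx => exact hx.subset (Function.support_const_smul_subset a x)

theorem DimGE.of_form_le {Q Q' : (V → ℂ) → ℝ} {m : V → ℝ} {a b : ℝ} (hb : 0 ≤ b)
    (h : ∀ f : V → ℂ, (Function.support f).Finite → Q' f ≤ a * nrmSq m f + b * Q f)
    {t : ℝ} {n : ℕ} (ht : DimGE Q m t n) : DimGE Q' m (a + b * t) n := by
  obtain ⟨g, hg, hs, hQ⟩ := ht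
  refine ⟨g, hg, hs, fun f hf => (h f (finite_support_of_mem_span hs hf)).trans ?_⟩
  nlinarith [mul_le_mul_of_nonneg_left (hQ f hf) hb]

theorem DimGE.nonneg {Q : (V → ℂ) → ℝ} {m : V → ℝ} (hQ : ∀ f, 0 ≤ Q f) (hm : ∀ x, 0 < m x)
    {t : ℝ} {n : ℕ} (ht : DimGE Q m t (n + 1)) : 0 ≤ t := by
  obtain ⟨g, hg, hs, hle⟩ := ht
  have h1 := hle (g 0) (Submodule.subset_span ⟨0, rfl⟩)
  have h2 := nrmSq_pos hm (hs 0) (hg.ne_zero 0)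
  exact nonneg_of_mul_nonneg_left ((hQ _).trans h1) h2

theorem bddBelow_setOf_dimGE {Q : (V → ℂ) → ℝ} {m : V → ℝ} (hQ : ∀ f, 0 ≤ Q f)
    (hm : ∀ x, 0 < m x) (n : ℕ) : BddBelow {t : ℝ | DimGE Q m t (n + 1)} :=
  ⟨0, fun _ ht => DimGE.nonneg hQ hm ht⟩

theorem eigVal_nonneg {Q : (V → ℂ) → ℝ} {m : V → ℝ} (hQ : ∀ f, 0 ≤ Q f)
    (hm : ∀ x, 0 < m x) (n : ℕ) : 0 ≤ eigVal Q m n :=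
  Real.sInf_nonneg fun _ ht => DimGE.nonneg hQ hm ht

/-- Monotonicity of the min-max values under affine domination of forms. -/
theorem eigVal_le_of_form_le {Q Q' : (V → ℂ) → ℝ} {m : V → ℝ} (hQ' : ∀ f, 0 ≤ Q' f)
    (hm : ∀ x, 0 < m x) {a b : ℝ} (hb : 0 < b)
    (h : ∀ f : V → ℂ, (Function.support f).Finite → Q' f ≤ a * nrmSq m f + b * Q f)
    {n : ℕ} (hne : {t : ℝ | DimGE Q m t (n + 1)}.Nonempty) :
    eigVal Q' m n ≤ a + b * eigVal Q m n := by
  have : (eigVal Q' m n - a) / b ≤ eigVal Q m n := by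
    refine le_csInf hne fun t ht => ?_
    rw [div_le_iff₀ hb]
    have := csInf_le (bddBelow_setOf_dimGE hQ' hm n) (DimGE.of_form_le hb.le h ht)
    rw [eigVal]
    linarith
  rw [div_le_iff₀ hb] at this
  linarith

/-- A subspace on which the degree form is at most `t` injects into functions on the
sublevel set `{deg ≤ t}`. -/
theorem DimGE.le_ncard {E : V → V → ℝ} {m : V → ℝ} (hm : ∀ x, 0 < m x) {t : ℝ} {n : ℕ}
    (ht : DimGE (degForm E m) m t n) (hfin : {v | degree E m v ≤ t}.Finite) :
    n ≤ {v | degree E m v ≤ t}.ncard := by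
  obtain ⟨g, hg, hs, hle⟩ := ht
  set S := {v | degree E m v ≤ t} with hS
  have : Fintype S := hfin.fintype
  have hd : Disjoint (Submodule.span ℂ (Set.range g))
      (LinearMap.ker (LinearMap.funLeft ℂ ℂ (Subtype.val : S → V))) := by
    rw [Submodule.disjoint_def]
    intro f hf hker
    by_contra hf0
    have hfS : ∀ x, degree E m x ≤ t → f x = 0 := fun x hx =>
      congrFun (LinearMap.mem_ker.1 hker) ⟨x, hx⟩
    have hsupp := finite_support_of_mem_span hs hf
    obtain ⟨x, hx⟩ := Function.ne_iff.1 hf0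
    have hpos : 0 < ∑' x, (m x * degree E m x - t * m x) * ‖f x‖ ^ 2 := by
      refine (summable_mul_norm_sq hsupp _).tsum_pos (fun y => ?_) x ?_
      · by_cases hy : degree E m y ≤ t
        · simp [hfS y hy]
        · exact mul_nonneg (by nlinarith [hm y]) (sq_nonneg _)
      · have hxt : t < degree E m x := not_le.1 fun h => hx (hfS x h)
        exact mul_pos (by nlinarith [hm x]) (pow_pos (norm_pos_iff.2 hx) 2)
    have h1 := hle f hf
    simp only [sub_mul, mul_assoc t] at hpos
    rw [(summable_mul_norm_sq hsupp _).tsum_sub ((summable_mul_norm_sq hsupp m).mul_left t),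
      tsum_mul_left] at hpos
    rw [nrmSq, degForm] at h1
    linarith
  have hcard := (hg.map hd).fintype_card_le_finrank
  rw [Fintype.card_fin, Module.finrank_fintype_fun_eq_card, ← Nat.card_eq_fintype_card] at hcard
  rwa [← Nat.card_coe_set_eq]

theorem exists_dimGE_degForm [Infinite V] (E : V → V → ℝ) {m : V → ℝ} (hm : ∀ x, 0 < m x)
    (n : ℕ) : ∃ t, DimGE (degForm E m) m t n := by
  set e : Fin n → V := fun i => Infinite.natEmbedding V i with he
  have hinj : Function.Injective e := fun i j hij =>
    Fin.ext ((Infinite.natEmbedding V).injective hij)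
  refine ⟨∑ i, |degree E m (e i)|, fun i => Pi.single (e i) 1,
    (Pi.linearIndependent_single_one V ℂ).comp e hinj, fun i => ?_, fun f hf => ?_⟩
  · exact (Set.finite_singleton (e i)).subset Pi.support_single_subset
  have hfe : ∀ x ∉ Set.range e, f x = 0 := by
    intro x hx
    induction hf using Submodule.span_induction with
    | mem y hy =>
      obtain ⟨i, rfl⟩ := hy
      exact Pi.single_eq_of_ne (fun h => hx ⟨i, h.symm⟩) _
    | zero => rfl
    | add y z _ _ hy hz => simp [hy, hz]
    | smul a y _ hy => simp [hy]
  have hsupp : (Function.support f).Finite :=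
    (Set.finite_range e).subset fun x hx => by_contra fun h => hx (hfe x h)
  rw [degForm, nrmSq, ← tsum_mul_left]
  refine (summable_mul_norm_sq hsupp _).tsum_le_tsum (fun x => ?_)
    ((summable_mul_norm_sq hsupp m).mul_left _)
  by_cases hx : x ∈ Set.range e
  · obtain ⟨i, rfl⟩ := hx
    have h1 : degree E m (e i) ≤ ∑ i, |degree E m (e i)| := (le_abs_self _).trans
      (Finset.single_le_sum (f := fun i => |degree E m (e i)|)
        (fun j _ => abs_nonneg _) (Finset.mem_univ i))
    have h2 : 0 ≤ m (e i) * ‖f (e i)‖ ^ 2 := mul_nonneg (hm _).le (sq_nonneg _)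
    nlinarith [mul_le_mul_of_nonneg_right h1 h2]
  · simp [hfe x hx]

/-- If the degree tends to infinity, so do the eigenvalues of the degree operator. -/
theorem tendsto_eigVal_degForm [Infinite V] {E : V → V → ℝ} {m : V → ℝ} (hm : ∀ x, 0 < m x)
    (hfin : ∀ C : ℝ, {v | degree E m v ≤ C}.Finite) :
    Filter.Tendsto (eigVal (degForm E m) m) Filter.atTop Filter.atTop := by
  refine Filter.tendsto_atTop.2 fun C => ?_
  filter_upwards [Filter.eventually_ge_atTop {v | degree E m v ≤ C}.ncard] with n hn
  refine le_csInf (exists_dimGE_degForm E hm (n + 1)) fun t ht => ?_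
  by_contra hlt
  have h1 := ht.le_ncard hm (hfin t)
  have h2 : {v | degree E m v ≤ t}.ncard ≤ {v | degree E m v ≤ C}.ncard :=
    Set.ncard_le_ncard (fun v (hv : degree E m v ≤ t) => hv.trans (not_le.1 hlt).le) (hfin C)
  omega

/-- The matrix of the magnetic Laplacian conjugated to act on unweighted `ℓ²`. -/
def symmLapMatrix [Fintype V] (E : V → V → ℝ) (m : V → ℝ) (θ : V → V → ℝ) : Matrix V V ℂ :=
  Matrix.of fun y z => ((√(m y) : ℝ) : ℂ)⁻¹ * ((√(m z) : ℝ) : ℂ)⁻¹ *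
    ((if y = z then ((∑ w, E y w : ℝ) : ℂ) else 0) -
      (E y z : ℂ) * Complex.exp (((θ y z : ℝ) : ℂ) * Complex.I))

theorem symmLapMatrix_isHermitian [Fintype V] {E : V → V → ℝ} {m : V → ℝ} {θ : V → V → ℝ}
    (h : GraphAxioms E m) (hθ : MagneticPotential E θ) : (symmLapMatrix E m θ).IsHermitian := by
  ext y z
  simp only [symmLapMatrix, Matrix.conjTranspose_apply, Matrix.of_apply, star_sub, star_mul',
    star_inv₀, Complex.star_def, Complex.conj_ofReal, apply_ite, map_zero, ← Complex.exp_conj,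
    map_mul, Complex.conj_I]
  rw [h.1 z y, hθ.1 y z]
  by_cases hyz : y = z
  · subst hyz; simp
  · simp only [hyz, Ne.symm hyz, if_false, zero_sub]
    push_cast
    ring_nf

theorem symmLapMatrix_mulVec [Fintype V] {E : V → V → ℝ} {m : V → ℝ} (θ : V → V → ℝ)
    (h : GraphAxioms E m) (g : V → ℂ) (y : V) :
    (symmLapMatrix E m θ).mulVec (fun z => ((√(m z) : ℝ) : ℂ) * g z) y =
      ((√(m y) : ℝ) : ℂ) * lap E m θ g y := by
  have hs : ∀ z, ((√(m z) : ℝ) : ℂ) ≠ 0 := fun z =>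
    Complex.ofReal_ne_zero.2 (Real.sqrt_pos.2 (h.2.2.2.1 z)).ne'
  have hm : ((m y : ℝ) : ℂ) = ((√(m y) : ℝ) : ℂ) * ((√(m y) : ℝ) : ℂ) := by
    rw [← Complex.ofReal_mul, Real.mul_self_sqrt (h.2.2.2.1 y).le]
  have hterm : ∀ z, symmLapMatrix E m θ y z * (((√(m z) : ℝ) : ℂ) * g z) =
      ((√(m y) : ℝ) : ℂ)⁻¹ * ((if y = z then ((∑ w, E y w : ℝ) : ℂ) * g y else 0) -
        (E y z : ℂ) * (Complex.exp (((θ y z : ℝ) : ℂ) * Complex.I) * g z)) := by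
    intro z
    have := hs z
    simp only [symmLapMatrix, Matrix.of_apply]
    by_cases hyz : y = z
    · subst hyz; simp only [if_true]; field_simp
    · simp only [hyz, if_false]; field_simp; ring
  rw [Matrix.mulVec, dotProduct, Finset.sum_congr rfl fun z _ => hterm z, ← Finset.mul_sum,
    Finset.sum_sub_distrib, Finset.sum_ite_eq, if_pos (Finset.mem_univ y), lap, tsum_fintype, hm,
    mul_inv, mul_assoc (_ : ℂ)⁻¹ (_ : ℂ)⁻¹, mul_inv_cancel_left₀ (hs y)]
  simp only [mul_sub, Finset.sum_sub_distrib, Complex.ofReal_sum, Finset.sum_mul]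

theorem re_sum_conj_mul_lap [Fintype V] {E : V → V → ℝ} {m : V → ℝ} (θ : V → V → ℝ)
    (h : GraphAxioms E m) (g : V → ℂ) :
    ∑ y, (m y : ℝ) * ((starRingEnd ℂ) (g y) * lap E m θ g y).re = quadForm E θ g := by
  have hterm : ∀ y, (m y : ℝ) * ((starRingEnd ℂ) (g y) * lap E m θ g y).re =
      ∑ z, E y z * ((starRingEnd ℂ) (g y) *
        (g y - Complex.exp (((θ y z : ℝ) : ℂ) * Complex.I) * g z)).re := by
    intro y
    have hm : ((m y : ℝ) : ℂ) ≠ 0 := Complex.ofReal_ne_zero.2 (h.2.2.2.1 y).ne'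
    simp only [← Complex.re_ofReal_mul, ← Complex.re_sum]
    congr 1
    rw [lap, tsum_fintype, mul_left_comm, mul_inv_cancel_left₀ hm,
      Finset.mul_sum]
    exact Finset.sum_congr rfl fun z _ => by ring
  have hsq : ∀ (t : ℝ) (a b : ℂ), ((starRingEnd ℂ) a *
      (a - Complex.exp ((t : ℂ) * Complex.I) * b)).re =
      (1 / 2) * ‖a - Complex.exp ((t : ℂ) * Complex.I) * b‖ ^ 2 +
        (1 / 2) * ‖a‖ ^ 2 - (1 / 2) * ‖b‖ ^ 2 := by
    intro t a b
    have hb : ‖b‖ ^ 2 = ‖Complex.exp ((t : ℂ) * Complex.I) * b‖ ^ 2 := by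
      rw [norm_mul, Complex.norm_exp_ofReal_mul_I, one_mul]
    rw [hb]
    generalize Complex.exp ((t : ℂ) * Complex.I) * b = c
    simp only [← Complex.normSq_eq_norm_sq, Complex.normSq_apply, Complex.mul_re, Complex.sub_re,
      Complex.sub_im, Complex.conj_re, Complex.conj_im]
    ring
  have hswap : ∑ y, ∑ z, E y z * ((1 / 2) * ‖g z‖ ^ 2) =
      ∑ y, ∑ z, E y z * ((1 / 2) * ‖g y‖ ^ 2) := by
    rw [Finset.sum_comm]
    exact Finset.sum_congr rfl fun y _ => Finset.sum_congr rfl fun z _ => by rw [h.1 z y]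
  simp only [hterm, hsq]
  simp only [mul_sub, mul_add, Finset.sum_sub_distrib, Finset.sum_add_distrib]
  rw [quadForm, tsum_fintype, Finset.mul_sum, hswap, add_sub_cancel_right]
  refine Finset.sum_congr rfl fun y _ => ?_
  rw [tsum_fintype, Finset.mul_sum]
  exact Finset.sum_congr rfl fun z _ => by ring

open scoped ComplexOrder in
/-- The variational lower bound for the bottom eigenvalue of a finite magnetic Laplacian. -/
theorem mul_sum_le_quadForm [Fintype V] {E : V → V → ℝ} {m : V → ℝ} {θ : V → V → ℝ}
    (h : GraphAxioms E m) (hθ : MagneticPotential E θ) {lam : ℝ}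
    (hlam : lam ∈ lowerBounds {t : ℝ | ∃ g : V → ℂ, g ≠ 0 ∧
      ∀ y, lap E m θ g y = (t : ℂ) * g y}) (g : V → ℂ) :
    lam * ∑ y, m y * ‖g y‖ ^ 2 ≤ quadForm E θ g := by
  have hs : ∀ z, ((√(m z) : ℝ) : ℂ) ≠ 0 := fun z =>
    Complex.ofReal_ne_zero.2 (Real.sqrt_pos.2 (h.2.2.2.1 z)).ne'
  set A := symmLapMatrix E m θ with hA
  have hB : (A - (lam : ℂ) • (1 : Matrix V V ℂ)).IsHermitian := by
    refine (symmLapMatrix_isHermitian h hθ).sub ?_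
    ext i j
    by_cases hij : i = j
    · subst hij; simp
    · simp [hij, Ne.symm hij]
  have hpsd : (A - (lam : ℂ) • (1 : Matrix V V ℂ)).PosSemidef := by
    rw [hB.posSemidef_iff_eigenvalues_nonneg]
    intro i
    have hv := hB.mulVec_eigenvectorBasis i
    have hv0 : (hB.eigenvectorBasis i).ofLp ≠ 0 := fun h0 =>
      hB.eigenvectorBasis.orthonormal.ne_zero i (by ext y; simp [h0])
    generalize (hB.eigenvectorBasis i).ofLp = v at hv hv0
    have hvs : (fun z => ((√(m z) : ℝ) : ℂ) * (((√(m z) : ℝ) : ℂ)⁻¹ * v z)) = v := by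
      funext z; rw [mul_inv_cancel_left₀ (hs z)]
    have hmem : lam ≤ hB.eigenvalues i + lam := by
      refine hlam ⟨fun z => ((√(m z) : ℝ) : ℂ)⁻¹ * v z, fun h0 => hv0 ?_, fun y => ?_⟩
      · rw [← hvs]; funext z; simp [congrFun h0 z]
      · have h1 := symmLapMatrix_mulVec θ h (fun z => ((√(m z) : ℝ) : ℂ)⁻¹ * v z) y
        rw [hvs] at h1
        have h2 := congrFun hv y
        rw [Matrix.sub_mulVec, Matrix.smul_mulVec, Matrix.one_mulVec, Pi.sub_apply, h1] at h2
        simp only [Pi.smul_apply, smul_eq_mul, Complex.real_smul] at h2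
        have := hs y
        apply mul_left_cancel₀ this
        push_cast
        rw [mul_left_comm _ (_ + _), mul_inv_cancel_left₀ this]
        linear_combination h2
    simpa using hmem
  have hnn := hpsd.re_dotProduct_nonneg (fun z => ((√(m z) : ℝ) : ℂ) * g z)
  rw [Matrix.sub_mulVec, Matrix.smul_mulVec, Matrix.one_mulVec, dotProduct] at hnn
  have hterm : ∀ y, (star (fun z => ((√(m z) : ℝ) : ℂ) * g z) y *
      (A.mulVec (fun z => ((√(m z) : ℝ) : ℂ) * g z) -
        (lam : ℂ) • fun z => ((√(m z) : ℝ) : ℂ) * g z) y).re =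
      m y * ((starRingEnd ℂ) (g y) * lap E m θ g y).re - lam * (m y * ‖g y‖ ^ 2) := by
    intro y
    have hm : ((m y : ℝ) : ℂ) = ((√(m y) : ℝ) : ℂ) * ((√(m y) : ℝ) : ℂ) := by
      rw [← Complex.ofReal_mul, Real.mul_self_sqrt (h.2.2.2.1 y).le]
    have hg : lam * (m y * ‖g y‖ ^ 2) =
        ((lam : ℂ) * ((m y : ℂ) * ((starRingEnd ℂ) (g y) * g y))).re := by
      rw [mul_comm _ (g y), Complex.mul_conj, Complex.normSq_eq_norm_sq, ← Complex.ofReal_mul,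
        ← Complex.ofReal_mul, Complex.ofReal_re]
    rw [hg, ← Complex.re_ofReal_mul, ← Complex.sub_re]
    congr 1
    rw [Pi.sub_apply, hA, symmLapMatrix_mulVec θ h g y]
    simp only [Pi.star_apply, Pi.smul_apply, smul_eq_mul, star_mul', Complex.star_def,
      Complex.conj_ofReal]
    rw [hm]
    ring
  simp only [RCLike.re_to_complex, Complex.re_sum] at hnn
  rw [Finset.sum_congr rfl fun y _ => hterm y, Finset.sum_sub_distrib, re_sum_conj_mul_lap θ h,
    ← Finset.mul_sum] at hnn
  linarith

theorem GraphAxioms.degree_pos {E : V → V → ℝ} {m : V → ℝ} (h : GraphAxioms E m)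
    (hc : Conn E) [Nontrivial V] (x : V) : 0 < degree E m x := by
  obtain ⟨z, hz⟩ := exists_ne x
  obtain rfl | ⟨b, hb, -⟩ := (hc x z).cases_head
  · exact absurd rfl hz
  · exact mul_pos (inv_pos.2 (h.2.2.2.1 x)) ((h.summable_edge x).tsum_pos (h.2.1 x) b hb)

theorem GraphAxioms.prod [Finite V2] {E1 : V1 → V1 → ℝ} {m1 : V1 → ℝ} {E2 : V2 → V2 → ℝ}
    {m2 : V2 → ℝ} (h1 : GraphAxioms E1 m1) (h2 : GraphAxioms E2 m2) (I : Set V2) :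
    GraphAxioms (prodE E1 E2 I) (prodM m1 m2) := by
  refine ⟨fun p q => ?_, fun p q => ?_, fun p => ?_,
    fun p => mul_pos (h1.2.2.2.1 _) (h2.2.2.2.1 _), fun p => ?_⟩
  · have hsnd : (p.2 = q.2 ∧ p.2 ∈ I) ↔ (q.2 = p.2 ∧ q.2 ∈ I) :=
      ⟨fun h => ⟨h.1.symm, h.1 ▸ h.2⟩, fun h => ⟨h.1.symm, h.1 ▸ h.2⟩⟩
    simp only [prodE, hsnd, eq_comm (a := p.1), h1.1 p.1, h2.1 p.2]
  · unfold prodE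
    have := h1.2.1 p.1 q.1
    have := h2.2.1 p.2 q.2
    split_ifs <;> linarith
  · simp [prodE, h1.2.2.1, h2.2.2.1]
  · refine (((h1.2.2.2.2 p.1).union (Set.finite_singleton p.1)).prod
      (Set.finite_univ (α := V2))).subset fun q hq => ⟨?_, Set.mem_univ _⟩
    by_contra hn
    simp only [Set.mem_union, Set.mem_ofPred_eq, Set.mem_singleton_iff, not_or, not_lt] at hn
    have hq' : 0 < prodE E1 E2 I p q := hq
    rw [prodE, if_neg (Ne.symm hn.2)] at hq'
    split_ifs at hq' <;> linarith [hn.1]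

theorem GraphAxioms.tsum_prodE [Fintype V2] {E1 : V1 → V1 → ℝ} {m1 : V1 → ℝ}
    {E2 : V2 → V2 → ℝ} {m2 : V2 → ℝ} (h1 : GraphAxioms E1 m1) (h2 : GraphAxioms E2 m2)
    (I : Set V2) (p : V1 × V2) :
    ∑' q, prodE E1 E2 I p q = (if p.2 ∈ I then ∑' a, E1 p.1 a else 0) + ∑' b, E2 p.2 b := by
  have hinner : ∀ a, ∑' b, prodE E1 E2 I p (a, b) =
      (if p.2 ∈ I then E1 p.1 a else 0) + (if a = p.1 then ∑' b, E2 p.2 b else 0) := by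
    intro a
    simp only [prodE, tsum_fintype, Finset.sum_add_distrib, ite_and, eq_comm (a := p.1)]
    congr 1
    · simp
    · split_ifs <;> simp
  have hs1 : Summable fun a => if p.2 ∈ I then E1 p.1 a else 0 := by
    split_ifs
    · exact h1.summable_edge p.1
    · exact summable_zero
  have hs2 : Summable fun a => if a = p.1 then ∑' b, E2 p.2 b else 0 :=
    summable_of_hasFiniteSupport <| (Set.finite_singleton p.1).subset fun a ha => by
      by_contra hne
      exact ha (if_neg hne)
  rw [((h1.prod h2 I).summable_edge p).tsum_prod, tsum_congr hinner, hs1.tsum_add hs2,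
    tsum_ite_eq]
  congr 1
  split_ifs <;> simp

theorem div_le_degree_prod [Fintype V2] {E1 : V1 → V1 → ℝ} {m1 : V1 → ℝ}
    {E2 : V2 → V2 → ℝ} {m2 : V2 → ℝ} (h1 : GraphAxioms E1 m1) (h2 : GraphAxioms E2 m2)
    (I : Set V2) (p : V1 × V2) :
    degree E2 m2 p.2 / m1 p.1 ≤ degree (prodE E1 E2 I) (prodM m1 m2) p := by
  have hm1 := h1.2.2.2.1 p.1
  have hm2 := h2.2.2.2.1 p.2
  have hnn : 0 ≤ if p.2 ∈ I then ∑' a, E1 p.1 a else 0 := by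
    split_ifs
    · exact tsum_nonneg (h1.2.1 _)
    · exact le_rfl
  rw [degree, degree, h1.tsum_prodE h2, prodM]
  calc (m2 p.2)⁻¹ * (∑' b, E2 p.2 b) / m1 p.1
      = (m1 p.1 * m2 p.2)⁻¹ * ∑' b, E2 p.2 b := by field_simp
    _ ≤ _ := mul_le_mul_of_nonneg_left (le_add_of_nonneg_left hnn) (by positivity)

theorem finite_setOf_degree_prod_le [Fintype V2] [Nontrivial V2] {E1 : V1 → V1 → ℝ}
    {m1 : V1 → ℝ} {E2 : V2 → V2 → ℝ} {m2 : V2 → ℝ} (h1 : GraphAxioms E1 m1)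
    (h2 : GraphAxioms E2 m2) (hc : Conn E2) (hH1 : H1cond m1) (I : Set V2) (C : ℝ) :
    {v | degree (prodE E1 E2 I) (prodM m1 m2) v ≤ C}.Finite := by
  have hC : 0 < max C 1 := lt_max_of_lt_right one_pos
  refine ((Set.finite_iUnion fun y => hH1.2 (degree E2 m2 y / max C 1)
    (div_pos (h2.degree_pos hc y) hC)).prod (Set.finite_univ (α := V2))).subset
    fun v hv => ⟨Set.mem_iUnion.2 ⟨v.2, ?_⟩, Set.mem_univ _⟩
  have h3 := ((div_le_degree_prod h1 h2 I v).trans hv).trans (le_max_left C 1)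
  rw [div_le_iff₀ (h1.2.2.2.1 _)] at h3
  rw [Set.mem_ofPred_eq, div_le_iff₀ hC]
  linarith

theorem degForm_prod_le [Fintype V2] {E1 : V1 → V1 → ℝ} {m1 : V1 → ℝ} {E2 : V2 → V2 → ℝ}
    {m2 : V2 → ℝ} (h1 : GraphAxioms E1 m1) (h2 : GraphAxioms E2 m2) (I : Set V2) {d : ℝ}
    (hd : ∀ x, degree E1 m1 x ≤ d) {f : V1 × V2 → ℂ} (hf : (Function.support f).Finite) :
    degForm (prodE E1 E2 I) (prodM m1 m2) f ≤
      (|d| * ∑ y, (m2 y)⁻¹) * nrmSq (prodM m1 m2) f +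
        (⨆ y, degree E2 m2 y) * ∑' p, m2 p.2 * ‖f p‖ ^ 2 := by
  rw [degForm, nrmSq, ← tsum_mul_left, ← tsum_mul_left, ← Summable.tsum_add
    ((summable_mul_norm_sq hf _).mul_left _) ((summable_mul_norm_sq hf _).mul_left _)]
  refine (summable_mul_norm_sq hf _).tsum_le_tsum (fun p => ?_)
    (((summable_mul_norm_sq hf _).mul_left _).add ((summable_mul_norm_sq hf _).mul_left _))
  have hm1 := h1.2.2.2.1 p.1
  have hm2 := h2.2.2.2.1 p.2
  have hfst : (if p.2 ∈ I then ∑' a, E1 p.1 a else 0) ≤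
      (|d| * ∑ y, (m2 y)⁻¹) * prodM m1 m2 p := by
    have hle : (if p.2 ∈ I then ∑' a, E1 p.1 a else 0) ≤ m1 p.1 * |d| := by
      split_ifs
      · rw [← h1.weight_mul_degree]
        exact mul_le_mul_of_nonneg_left ((hd _).trans (le_abs_self d)) hm1.le
      · positivity
    have hinv : 1 ≤ (∑ y, (m2 y)⁻¹) * m2 p.2 := by
      rw [← inv_mul_cancel₀ hm2.ne']
      exact mul_le_mul_of_nonneg_right (Finset.single_le_sum (f := fun y => (m2 y)⁻¹)
        (fun y _ => inv_nonneg.2 (h2.2.2.2.1 y).le) (Finset.mem_univ p.2)) hm2.le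
    calc _ ≤ m1 p.1 * |d| := hle
      _ ≤ (m1 p.1 * |d|) * ((∑ y, (m2 y)⁻¹) * m2 p.2) :=
        le_mul_of_one_le_right (by positivity) hinv
      _ = _ := by rw [prodM]; ring
  have hsnd : ∑' b, E2 p.2 b ≤ (⨆ y, degree E2 m2 y) * m2 p.2 := by
    rw [← h2.weight_mul_degree, mul_comm]
    exact mul_le_mul_of_nonneg_right
      (le_ciSup (f := fun y => degree E2 m2 y) (Set.finite_range _).bddAbove p.2) hm2.le
  rw [(h1.prod h2 I).weight_mul_degree, h1.tsum_prodE h2]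
  nlinarith [mul_le_mul_of_nonneg_right (add_le_add hfst hsnd) (sq_nonneg ‖f p‖)]

/-- The form of the product dominates the sum of the forms of the fibers, hence the bottom
eigenvalue of the fibers. -/
theorem mul_tsum_le_quadForm_prod [Fintype V2] {E1 : V1 → V1 → ℝ} {m1 : V1 → ℝ}
    {θ1 : V1 → V1 → ℝ} {E2 : V2 → V2 → ℝ} {m2 : V2 → ℝ} {θ2 : V2 → V2 → ℝ}
    (h1 : GraphAxioms E1 m1) (h2 : GraphAxioms E2 m2) (hθ1 : MagneticPotential E1 θ1)
    (hθ2 : MagneticPotential E2 θ2) (I : Set V2) {lam : ℝ}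
    (hlam : lam ∈ lowerBounds {t : ℝ | ∃ g : V2 → ℂ, g ≠ 0 ∧
      ∀ y, lap E2 m2 θ2 g y = (t : ℂ) * g y})
    {f : V1 × V2 → ℂ} (hf : (Function.support f).Finite) :
    lam * ∑' p, m2 p.2 * ‖f p‖ ^ 2 ≤ quadForm (prodE E1 E2 I) (prodTheta θ1 θ2) f := by
  set F : (V1 × V2) × (V1 × V2) → ℝ := fun p => prodE E1 E2 I p.1 p.2 *
    ‖f p.1 - Complex.exp (((prodTheta θ1 θ2 p.1 p.2 : ℝ) : ℂ) * Complex.I) * f p.2‖ ^ 2 with hF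
  have hFs : Summable F := (h1.prod h2 I).summable_energy _ hf
  let e : V1 × (V2 × V2) → (V1 × V2) × (V1 × V2) := fun q => ((q.1, q.2.1), (q.1, q.2.2))
  have he : Function.Injective e := by
    rintro ⟨x, y, z⟩ ⟨x', y', z'⟩ h
    simp only [e, Prod.mk.injEq] at h
    simp [h.1.1, h.1.2, h.2.2]
  have hFe : ∀ x y z, F (e (x, (y, z))) = E2 y z *
      ‖f (x, y) - Complex.exp (((θ2 y z : ℝ) : ℂ) * Complex.I) * f (x, z)‖ ^ 2 := by
    intro x y z
    simp [hF, e, prodE, prodTheta, h1.2.2.1 x, hθ1.2 x x (h1.2.2.1 x)]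
  have hFes : Summable (F ∘ e) := hFs.comp_injective he
  have hfiber : ∀ x, ∑' q, (F ∘ e) (x, q) = 2 * quadForm E2 θ2 fun y => f (x, y) := by
    intro x
    rw [Summable.tsum_prod (Summable.of_finite), quadForm]
    simp only [Function.comp_apply, hFe]
    ring
  have hle : ∑' q, (F ∘ e) q ≤ ∑' p, F p := tsum_comp_le_tsum_of_inj hFs
    (fun p => mul_nonneg ((h1.prod h2 I).2.1 _ _) (sq_nonneg _)) he
  rw [hFes.tsum_prod, tsum_congr hfiber, tsum_mul_left] at hle
  have hQs : Summable fun x => quadForm E2 θ2 fun y => f (x, y) := by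
    have := hFes.prod.congr fun x => hfiber x
    exact (summable_mul_left_iff (two_ne_zero' ℝ)).1 this
  have hws := summable_mul_norm_sq hf fun p => m2 p.2
  rw [hws.tsum_prod, ← tsum_mul_left, (h1.prod h2 I).quadForm_eq _ hf]
  have hmono := (hws.prod.mul_left lam).tsum_le_tsum (fun x => by
    rw [tsum_fintype]
    exact mul_sum_le_quadForm h2 hθ2 hlam fun y => f (x, y)) hQs
  linarith

/-- For a discrete cusp `G = G1 ×_I G2` with `|V2| ≥ 2` and
`λ1 = inf σ(Δ_{G2,θ2}) > 0`: the form domains of `Δ_{G,θ}` and `deg_G(·)` coincide,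
`deg_G → ∞`, `Δ_{G,θ}` has compact resolvent, and
`0 < λ1/D ≤ liminf λ_n(Δ_{G,θ})/λ_n(deg_G) ≤ limsup ≤ 2` where `D = max deg_{G2}`. -/
theorem eigenvalue_asymptotics_vs_degree
    [Fintype V2]
    (E1 : V1 → V1 → ℝ) (m1 : V1 → ℝ) (θ1 : V1 → V1 → ℝ)
    (E2 : V2 → V2 → ℝ) (m2 : V2 → ℝ) (θ2 : V2 → V2 → ℝ)
    (I : Set V2) (hI : I.Nonempty) (hcard : 2 ≤ Fintype.card V2)
    (hG1 : GraphAxioms E1 m1) (hG2 : GraphAxioms E2 m2)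
    (hθ1 : MagneticPotential E1 θ1) (hθ2 : MagneticPotential E2 θ2)
    (hconn1 : Conn E1) (hconn2 : Conn E2)
    (hH1 : H1cond m1) (hH3 : H3cond E1 m1)
    (lam1 : ℝ)
    (hlam1 : IsLeast {t : ℝ | ∃ g : V2 → ℂ, g ≠ 0 ∧
      ∀ y, lap E2 m2 θ2 g y = (t : ℂ) * g y} lam1)
    (hlam1pos : 0 < lam1)
    (D : ℝ) (hD : D = ⨆ y, degree E2 m2 y) :
    SameFormDomain (quadForm (prodE E1 E2 I) (prodTheta θ1 θ2))
        (degForm (prodE E1 E2 I) (prodM m1 m2)) (prodM m1 m2) ∧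
      (∀ C : ℝ, {v : V1 × V2 | degree (prodE E1 E2 I) (prodM m1 m2) v ≤ C}.Finite) ∧
      CompactResolvent (quadForm (prodE E1 E2 I) (prodTheta θ1 θ2)) (prodM m1 m2) ∧
      0 < lam1 / D ∧
      lam1 / D ≤
        Filter.liminf (fun n : ℕ =>
          eigVal (quadForm (prodE E1 E2 I) (prodTheta θ1 θ2)) (prodM m1 m2) n /
            eigVal (degForm (prodE E1 E2 I) (prodM m1 m2)) (prodM m1 m2) n)
          Filter.atTop ∧
      Filter.liminf (fun n : ℕ =>
          eigVal (quadForm (prodE E1 E2 I) (prodTheta θ1 θ2)) (prodM m1 m2) n /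
            eigVal (degForm (prodE E1 E2 I) (prodM m1 m2)) (prodM m1 m2) n)
          Filter.atTop ≤
        Filter.limsup (fun n : ℕ =>
          eigVal (quadForm (prodE E1 E2 I) (prodTheta θ1 θ2)) (prodM m1 m2) n /
            eigVal (degForm (prodE E1 E2 I) (prodM m1 m2)) (prodM m1 m2) n)
          Filter.atTop ∧
      Filter.limsup (fun n : ℕ =>
          eigVal (quadForm (prodE E1 E2 I) (prodTheta θ1 θ2)) (prodM m1 m2) n /
            eigVal (degForm (prodE E1 E2 I) (prodM m1 m2)) (prodM m1 m2) n)
          Filter.atTop ≤ 2 := by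
  have : Nontrivial V2 := Fintype.one_lt_card_iff_nontrivial.1 hcard
  have : Infinite V1 := hH1.1
  have hP := hG1.prod hG2 I
  have hm : ∀ p, 0 < prodM m1 m2 p := hP.2.2.2.1
  obtain ⟨d, hd⟩ := hH3
  obtain ⟨y0⟩ : Nonempty V2 := inferInstance
  have hDpos : 0 < D := hD ▸ (hG2.degree_pos hconn2 y0).trans_le
    (le_ciSup (f := fun y => degree E2 m2 y) (Set.finite_range _).bddAbove y0)
  set Q := quadForm (prodE E1 E2 I) (prodTheta θ1 θ2)
  set A := degForm (prodE E1 E2 I) (prodM m1 m2)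
  set C := |d| * ∑ y, (m2 y)⁻¹
  have hC0 : 0 ≤ C := mul_nonneg (abs_nonneg d)
    (Finset.sum_nonneg fun y _ => inv_nonneg.2 (hG2.2.2.2.1 y).le)
  have hb : 0 < D / lam1 := div_pos hDpos hlam1pos
  have hQ0 : ∀ f, 0 ≤ Q f := hP.quadForm_nonneg _
  have hA0 : ∀ f, 0 ≤ A f := hP.degForm_nonneg
  have hup : ∀ f : V1 × V2 → ℂ, (Function.support f).Finite →
      Q f ≤ 0 * nrmSq (prodM m1 m2) f + 2 * A f := fun f hf => by
    rw [zero_mul, zero_add]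
    exact hP.quadForm_le_two_mul_degForm _ hf
  have hlow : ∀ f : V1 × V2 → ℂ, (Function.support f).Finite →
      A f ≤ C * nrmSq (prodM m1 m2) f + D / lam1 * Q f := fun f hf => by
    have hdeg := degForm_prod_le hG1 hG2 I hd hf
    rw [← hD] at hdeg
    have hquad := mul_tsum_le_quadForm_prod hG1 hG2 hθ1 hθ2 I hlam1.2 hf
    rw [mul_comm, ← le_div_iff₀ hlam1pos] at hquad
    have hmul := mul_le_mul_of_nonneg_left hquad hDpos.le
    rw [← mul_div_assoc, mul_div_right_comm] at hmul
    linarith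
  have hfin : ∀ t : ℝ, {v | degree (prodE E1 E2 I) (prodM m1 m2) v ≤ t}.Finite :=
    finite_setOf_degree_prod_le hG1 hG2 hconn2 hH1 I
  have hneA : ∀ n, {t : ℝ | DimGE A (prodM m1 m2) t (n + 1)}.Nonempty := fun n =>
    exists_dimGE_degForm _ hm (n + 1)
  have hneQ : ∀ n, {t : ℝ | DimGE Q (prodM m1 m2) t (n + 1)}.Nonempty := fun n =>
    let ⟨_, ht⟩ := hneA n
    ⟨_, ht.of_form_le zero_le_two hup⟩
  have hupper : ∀ n, eigVal Q (prodM m1 m2) n ≤ 2 * eigVal A (prodM m1 m2) n := fun n => by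
    simpa using eigVal_le_of_form_le hQ0 hm two_pos hup (hneA n)
  have hlower : ∀ n, eigVal A (prodM m1 m2) n ≤ C + D / lam1 * eigVal Q (prodM m1 m2) n :=
    fun n => eigVal_le_of_form_le hA0 hm hb hlow (hneQ n)
  have htend : Filter.Tendsto (eigVal A (prodM m1 m2)) Filter.atTop Filter.atTop :=
    tendsto_eigVal_degForm hm hfin
  have hratio0 : ∀ n, 0 ≤ eigVal Q (prodM m1 m2) n / eigVal A (prodM m1 m2) n := fun n =>
    div_nonneg (eigVal_nonneg hQ0 hm n) (eigVal_nonneg hA0 hm n)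
  have hratio2 : ∀ n, eigVal Q (prodM m1 m2) n / eigVal A (prodM m1 m2) n ≤ 2 := fun n =>
    div_le_of_le_mul₀ (eigVal_nonneg hA0 hm n) zero_le_two (hupper n)
  have hbdd : Filter.IsBoundedUnder (· ≤ ·) Filter.atTop fun n : ℕ =>
      eigVal Q (prodM m1 m2) n / eigVal A (prodM m1 m2) n :=
    Filter.isBoundedUnder_of ⟨2, hratio2⟩
  have hbdd' : Filter.IsBoundedUnder (· ≥ ·) Filter.atTop fun n : ℕ =>
      eigVal Q (prodM m1 m2) n / eigVal A (prodM m1 m2) n :=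
    Filter.isBoundedUnder_of ⟨0, hratio0⟩
  refine ⟨⟨1 / 2, 1 + C + D / lam1, by norm_num, by positivity, fun f hf => ⟨?_, ?_⟩⟩, hfin,
    fun t => ⟨_, fun k hk => (hk.of_form_le hb.le hlow).le_ncard hm (hfin _)⟩,
    div_pos hlam1pos hDpos, ?_, Filter.liminf_le_limsup hbdd hbdd',
    Filter.limsup_le_of_le hbdd'.isCoboundedUnder_le (Filter.Eventually.of_forall hratio2)⟩
  · linarith [hup f hf, nrmSq_nonneg hm f]
  · nlinarith [hlow f hf, mul_nonneg hb.le (nrmSq_nonneg hm f), mul_nonneg hC0 (hQ0 f), hQ0 f]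
  · have hlim : Filter.Tendsto (fun n => lam1 / D - lam1 / D * C / eigVal A (prodM m1 m2) n)
        Filter.atTop (nhds (lam1 / D)) := by
      simpa using (htend.const_div_atTop (lam1 / D * C)).const_sub (lam1 / D)
    rw [← hlim.liminf_eq]
    refine Filter.liminf_le_liminf ?_ hlim.isBoundedUnder_ge hbdd.isCoboundedUnder_ge
    filter_upwards [htend.eventually_gt_atTop 0] with n hn
    have hmul := mul_le_mul_of_nonneg_left (hlower n) (div_pos hlam1pos hDpos).le
    have hcancel : lam1 / D * (D / lam1) = 1 := by field_simp
    rw [mul_add, ← mul_assoc (lam1 / D) (D / lam1), hcancel, one_mul] at hmul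
    rw [sub_le_iff_le_add, ← add_div, le_div_iff₀ hn]
    linarith

end MagneticCusp
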